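/- arXiv:1106.5855 — 6 statements merged into one kernel-verified Lean document; each statement's English description precedes it below -/
import Mathlib

section
/- Let H be a real Hilbert space, D a nonempty closed convex subset of H, and T : D → D a nonexpansive mapping with F(T) ≠ ∅. Let L ∈ (0,1) and let f_n : D → D (n ≥ 0) satisfy ‖f_n(x) − f_n(y)‖ ≤ L‖x − y‖ for all x, y ∈ D and all n, and suppose {f_n} converges uniformly on D to a contraction f : D → D. Let g_n : D → D, let M > 0 and δ_n ≥ 0 with β_n‖g_n(x) − x‖ ≤ δ_n(‖x‖ + M) for all x ∈ D and all n, and ∑_{n=0}^∞ δ_n < ∞. Let α_n ∈ [0,1] with α_n → 0 and ∑_{n=0}^∞ α_n = ∞, and β_n ∈ (0,1]. Define the iterative process x_0 ∈ D, x_{n+1} = α_n f_n(x_n) + (1 − α_n) T y_n, y_n = β_n g_n(x_n) + (1 − β_n) T x_n. Assume {x_n} is bounded and ‖T x_n − x_n‖ → 0. If q ∈ F(T) satisfies ⟨q − f(q), q − p⟩ ≤ 0 for all p ∈ F(T), then {x_n} converges strongly to q. -/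
open Filter Topology
open scoped InnerProductSpace

/-- A bounded sequence in a Hilbert space converges weakly along every ultrafilter. -/
theorem exists_weak_limit_of_bounded {H ι : Type*} [NormedAddCommGroup H] [InnerProductSpace ℝ H]
    [CompleteSpace H] (U : Ultrafilter ι) (x : ι → H) (R : ℝ) (hx : ∀ n, ‖x n‖ ≤ R) :
    ∃ w : H, ∀ v : H, Tendsto (fun n => ⟪x n, v⟫_ℝ) U (𝓝 ⟪w, v⟫_ℝ) := by
  let φ : ι → WeakDual ℝ H := fun n =>
    StrongDual.toWeakDual (InnerProductSpace.toDual ℝ H (x n))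
  have hφ : (U.map φ : Filter (WeakDual ℝ H)) ≤
      𝓟 (WeakDual.toStrongDual ⁻¹' Metric.closedBall (0 : StrongDual ℝ H) R) := by
    rw [le_principal_iff]
    refine Filter.mem_map.2 (Filter.Eventually.of_forall fun n => ?_)
    change InnerProductSpace.toDual ℝ H (x n) ∈ Metric.closedBall 0 R
    simpa using hx n
  obtain ⟨ψ, -, hψ⟩ := (WeakDual.isCompact_closedBall (0 : StrongDual ℝ H) R).ultrafilter_le_nhds
    (U.map φ) hφ
  refine ⟨(InnerProductSpace.toDual ℝ H).symm (WeakDual.toStrongDual ψ), fun v => ?_⟩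
  have h : Tendsto (fun n => φ n v) U (𝓝 (ψ v)) :=
    ((WeakDual.eval_continuous v).tendsto ψ).comp hψ
  rw [InnerProductSpace.toDual_symm_apply]
  exact h

/-- A closed convex set contains the weak limits of its sequences. -/
theorem weak_limit_mem_of_convex {H ι : Type*} [NormedAddCommGroup H] [InnerProductSpace ℝ H]
    [CompleteSpace H] {D : Set H} (hDcl : IsClosed D) (hDcv : Convex ℝ D) {l : Filter ι} [l.NeBot]
    {x : ι → H} (hx : ∀ n, x n ∈ D) {w : H}
    (hw : ∀ v : H, Tendsto (fun n => ⟪x n, v⟫_ℝ) l (𝓝 ⟪w, v⟫_ℝ)) : w ∈ D := by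
  obtain ⟨i⟩ := l.nonempty_of_neBot
  obtain ⟨p, hpD, hp⟩ := exists_norm_eq_iInf_of_complete_convex ⟨x i, hx i⟩ hDcl.isComplete hDcv w
  rw [norm_eq_iInf_iff_real_inner_le_zero hDcv hpD] at hp
  have h0 : ⟪w, w - p⟫_ℝ ≤ ⟪p, w - p⟫_ℝ := by
    refine le_of_tendsto (hw (w - p)) (Eventually.of_forall fun n => ?_)
    have := hp (x n) (hx n)
    rw [real_inner_comm, inner_sub_left] at this
    linarith
  have h1 : ⟪w - p, w - p⟫_ℝ ≤ 0 := by
    rw [inner_sub_left]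
    linarith
  rw [real_inner_self_nonpos, sub_eq_zero] at h1
  exact h1 ▸ hpD

/-- Demiclosedness principle: weak limits of approximate fixed points of a nonexpansive map are
fixed points. -/
theorem weak_limit_fixed_of_nonexpansive {H ι : Type*} [NormedAddCommGroup H]
    [InnerProductSpace ℝ H] {D : Set H} {T : H → H}
    (hT : ∀ x ∈ D, ∀ y ∈ D, ‖T x - T y‖ ≤ ‖x - y‖) {l : Filter ι} [l.NeBot]
    {x : ι → H} (hx : ∀ n, x n ∈ D) {R : ℝ} (hR : ∀ n, ‖x n‖ ≤ R)
    (hTx : Tendsto (fun n => ‖T (x n) - x n‖) l (𝓝 0)) {w : H} (hwD : w ∈ D)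
    (hw : ∀ v : H, Tendsto (fun n => ⟪x n, v⟫_ℝ) l (𝓝 ⟪w, v⟫_ℝ)) : T w = w := by
  have hb : ∀ n, ‖w - T w‖ ^ 2 ≤ ‖T (x n) - x n‖ ^ 2
      + 2 * (R + ‖w‖) * ‖T (x n) - x n‖ - 2 * (⟪x n, w - T w⟫_ℝ - ⟪w, w - T w⟫_ℝ) := by
    intro n
    have h1 : ‖x n - T w‖ ≤ ‖T (x n) - x n‖ + ‖x n - w‖ := by
      have h2 := norm_sub_le_norm_sub_add_norm_sub (x n) (T (x n)) (T w)
      have h3 := hT _ (hx n) _ hwD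
      rw [norm_sub_rev (x n) (T (x n))] at h2
      linarith
    have h4 : ‖x n - T w‖ ^ 2
        = ‖x n - w‖ ^ 2 + 2 * ⟪x n - w, w - T w⟫_ℝ + ‖w - T w‖ ^ 2 := by
      rw [← norm_add_sq_real, sub_add_sub_cancel]
    have h5 : ‖x n - w‖ ≤ R + ‖w‖ := (norm_sub_le _ _).trans (by linarith [hR n])
    have h6 := pow_le_pow_left₀ (norm_nonneg _) h1 2
    have h7 := mul_le_mul_of_nonneg_right h5 (norm_nonneg (T (x n) - x n))
    rw [inner_sub_left] at h4
    nlinarith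
  have hlim : Tendsto (fun n => ‖T (x n) - x n‖ ^ 2 + 2 * (R + ‖w‖) * ‖T (x n) - x n‖
      - 2 * (⟪x n, w - T w⟫_ℝ - ⟪w, w - T w⟫_ℝ)) l (𝓝 0) := by
    have := ((hTx.pow 2).add (hTx.const_mul (2 * (R + ‖w‖)))).sub
      (((hw (w - T w)).sub_const ⟪w, w - T w⟫_ℝ).const_mul 2)
    simpa using this
  have h0 : ‖w - T w‖ ^ 2 ≤ 0 := ge_of_tendsto' hlim hb
  have h1 : ‖w - T w‖ = 0 := by
    rwa [sq_nonpos_iff] at h0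
  exact (sub_eq_zero.1 (norm_eq_zero.1 h1)).symm

/-- A variational inequality over the fixed point set of a nonexpansive map passes to bounded
sequences of approximate fixed points. -/
theorem eventually_inner_lt_of_approx_fixed {H : Type*} [NormedAddCommGroup H]
    [InnerProductSpace ℝ H] [CompleteSpace H] {D : Set H} (hDcl : IsClosed D) (hDcv : Convex ℝ D)
    {T : H → H} (hT : ∀ x ∈ D, ∀ y ∈ D, ‖T x - T y‖ ≤ ‖x - y‖)
    {x : ℕ → H} (hx : ∀ n, x n ∈ D) {R : ℝ} (hR : ∀ n, ‖x n‖ ≤ R)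
    (hTx : Tendsto (fun n => ‖T (x n) - x n‖) atTop (𝓝 0)) {u q : H}
    (hvar : ∀ p ∈ D, T p = p → ⟪u, p - q⟫_ℝ ≤ 0) {ε : ℝ} (hε : 0 < ε) :
    ∀ᶠ n in atTop, ⟪u, x n - q⟫_ℝ < ε := by
  by_contra hcon
  have hfr : ∃ᶠ n in atTop, ε ≤ ⟪u, x n - q⟫_ℝ := by
    simpa only [not_eventually, not_lt] using hcon
  have : (atTop ⊓ 𝓟 {n | ε ≤ ⟪u, x n - q⟫_ℝ}).NeBot := frequently_mem_iff_neBot.1 hfr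
  let U := Ultrafilter.of (atTop ⊓ 𝓟 {n | ε ≤ ⟪u, x n - q⟫_ℝ})
  have hU : (U : Filter ℕ) ≤ atTop ⊓ 𝓟 {n | ε ≤ ⟪u, x n - q⟫_ℝ} := Ultrafilter.of_le _
  obtain ⟨w, hw⟩ := exists_weak_limit_of_bounded U x R hR
  have hwD := weak_limit_mem_of_convex hDcl hDcv hx hw
  have hwT := weak_limit_fixed_of_nonexpansive hT hx hR
    (hTx.mono_left (hU.trans inf_le_left)) hwD hw
  have hlim : Tendsto (fun n => ⟪u, x n - q⟫_ℝ) U (𝓝 ⟪u, w - q⟫_ℝ) := by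
    simp only [real_inner_comm _ u, inner_sub_left]
    exact (hw u).sub_const _
  have hge : ε ≤ ⟪u, w - q⟫_ℝ :=
    ge_of_tendsto hlim (le_principal_iff.1 (hU.trans inf_le_right))
  linarith [hvar w hwD hwT]

/-- A nonnegative real sequence contracted with non-summable rates, up to errors that are negligible
relative to the rates or summable, tends to zero. -/
theorem tendsto_zero_of_le_one_sub_mul_add {s γ c : ℕ → ℝ} (hs : ∀ n, 0 ≤ s n)
    (hγ : ∀ n, 0 ≤ γ n) (hγ1 : ∀ᶠ n in atTop, γ n ≤ 1) (hγdiv : ¬ Summable γ)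
    (hc : ∀ n, 0 ≤ c n) (hcsum : Summable c)
    (hrec : ∀ ε > 0, ∀ᶠ n in atTop, s (n + 1) ≤ (1 - γ n) * s n + γ n * ε + c n) :
    Tendsto s atTop (𝓝 0) := by
  have key : ∀ ε > 0, ∀ᶠ n in atTop, s n < ε := by
    intro ε hε
    have hε3 : 0 < ε / 3 := by positivity
    obtain ⟨N, hN⟩ := eventually_atTop.1 ((hγ1.and (hrec _ hε3)).and
      ((tendsto_sum_nat_add c).eventually_lt_const hε3))
    have hbound : ∀ m, s (m + N) ≤ Real.exp (-∑ i ∈ Finset.range m, γ (i + N)) * s N + ε / 3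
        + ∑ i ∈ Finset.range m, c (i + N) := by
      intro m
      induction m with
      | zero => simp; linarith
      | succ m ih =>
        obtain ⟨⟨h1, h2⟩, -⟩ := hN (m + N) (by omega)
        rw [Finset.sum_range_succ, Finset.sum_range_succ, neg_add, Real.exp_add,
          show m + 1 + N = m + N + 1 by omega]
        have h3 := mul_le_mul_of_nonneg_left ih (sub_nonneg.2 h1)
        have h4 : 1 - γ (m + N) ≤ Real.exp (-γ (m + N)) := Real.one_sub_le_exp_neg _
        have h5 := mul_le_mul_of_nonneg_right h4
          (mul_nonneg (Real.exp_pos (-∑ i ∈ Finset.range m, γ (i + N))).le (hs N))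
        have h6 := mul_nonneg (hγ (m + N))
          (Finset.sum_nonneg fun i (_ : i ∈ Finset.range m) => hc (i + N))
        nlinarith
    have hdiv : Tendsto (fun m => ∑ i ∈ Finset.range m, γ (i + N)) atTop atTop :=
      (not_summable_iff_tendsto_nat_atTop_of_nonneg fun i => hγ (i + N)).1
        (by rwa [summable_nat_add_iff])
    have hexp : Tendsto (fun m => Real.exp (-∑ i ∈ Finset.range m, γ (i + N)) * s N)
        atTop (𝓝 0) := by
      simpa using (Real.tendsto_exp_neg_atTop_nhds_zero.comp hdiv).mul_const (s N)
    have hev : ∀ᶠ m in atTop, s (m + N) < ε := by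
      filter_upwards [hexp.eventually_lt_const hε3] with m hm
      have h1 := ((summable_nat_add_iff N).2 hcsum).sum_le_tsum (Finset.range m)
        fun i _ => hc (i + N)
      have h2 := (hN N le_rfl).2
      linarith [hbound m]
    obtain ⟨m₀, hm₀⟩ := eventually_atTop.1 hev
    refine eventually_atTop.2 ⟨m₀ + N, fun n hn => ?_⟩
    have := hm₀ (n - N) (by omega)
    rwa [Nat.sub_add_cancel (by omega)] at this
  refine tendsto_order.2 ⟨fun b hb => Eventually.of_forall fun n => hb.trans_le (hs n), key⟩

/-- The subdifferential inequality for the square norm at `u + v`. -/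
theorem norm_add_sq_le_norm_sq_add_inner {H : Type*} [NormedAddCommGroup H]
    [InnerProductSpace ℝ H] (u v : H) : ‖u + v‖ ^ 2 ≤ ‖v‖ ^ 2 + 2 * ⟪u, u + v⟫_ℝ := by
  rw [norm_add_sq_real, inner_add_right, real_inner_self_eq_norm_sq]
  nlinarith [sq_nonneg ‖u‖]

/-- Theorem 2.1 of the paper, in the Hilbert-space setting. -/
theorem extended_ishikawa_convergence
    {H : Type*} [NormedAddCommGroup H] [InnerProductSpace ℝ H] [CompleteSpace H]
    (D : Set H) (hDne : D.Nonempty) (hDcl : IsClosed D) (hDcv : Convex ℝ D)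
    (T : H → H) (hTmaps : Set.MapsTo T D D)
    (hTne : ∀ x ∈ D, ∀ y ∈ D, ‖T x - T y‖ ≤ ‖x - y‖)
    (hFne : ∃ p ∈ D, T p = p)
    (L : ℝ) (hL : L ∈ Set.Ioo (0 : ℝ) 1)
    (fn : ℕ → H → H) (hfnmaps : ∀ n, Set.MapsTo (fn n) D D)
    (hfnL : ∀ n, ∀ x ∈ D, ∀ y ∈ D, ‖fn n x - fn n y‖ ≤ L * ‖x - y‖)
    (f : H → H) (hfmaps : Set.MapsTo f D D)
    (a : ℝ) (ha : a ∈ Set.Ioo (0 : ℝ) 1)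
    (hf : ∀ x ∈ D, ∀ y ∈ D, ‖f x - f y‖ ≤ a * ‖x - y‖)
    (hunif : TendstoUniformlyOn fn f atTop D)
    (gn : ℕ → H → H) (hgnmaps : ∀ n, Set.MapsTo (gn n) D D)
    (M : ℝ) (hM : 0 < M)
    (δ : ℕ → ℝ) (hδ : ∀ n, 0 ≤ δ n) (hδsum : Summable δ)
    (α β : ℕ → ℝ)
    (hα : ∀ n, α n ∈ Set.Icc (0 : ℝ) 1)
    (hα0 : Tendsto α atTop (𝓝 0))
    (hαdiv : ¬ Summable α)
    (hβ : ∀ n, β n ∈ Set.Ioc (0 : ℝ) 1)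
    (hgδ : ∀ n, ∀ x ∈ D, β n * ‖gn n x - x‖ ≤ δ n * (‖x‖ + M))
    (x y : ℕ → H) (hx0 : x 0 ∈ D)
    (hxrec : ∀ n, x (n + 1) = α n • fn n (x n) + (1 - α n) • T (y n))
    (hyrec : ∀ n, y n = β n • gn n (x n) + (1 - β n) • T (x n))
    (hxbdd : Bornology.IsBounded (Set.range x))
    (hTx : Tendsto (fun n => ‖T (x n) - x n‖) atTop (𝓝 0))
    (q : H) (hqD : q ∈ D) (hqfix : T q = q)
    (hvar : ∀ p ∈ D, T p = p → ⟪q - f q, q - p⟫_ℝ ≤ 0) :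
    Tendsto x atTop (𝓝 q) := by
  obtain ⟨R, hR⟩ := hxbdd.exists_norm_le
  replace hR : ∀ n, ‖x n‖ ≤ R := fun n => hR _ ⟨n, rfl⟩
  have hyD : ∀ n, x n ∈ D → y n ∈ D := fun n hn => by
    rw [hyrec]
    exact hDcv (hgnmaps n hn) (hTmaps hn) (hβ n).1.le (by linarith [(hβ n).2]) (by ring)
  have hxD : ∀ n, x n ∈ D := by
    intro n
    induction n with
    | zero => exact hx0
    | succ n ih =>
      rw [hxrec]
      exact hDcv (hfnmaps n ih) (hTmaps (hyD n ih)) (hα n).1 (by linarith [(hα n).2]) (by ring)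
  have hR0 : 0 ≤ R := (norm_nonneg _).trans (hR 0)
  obtain ⟨B, hB⟩ : ∃ B, B = R + ‖q‖ := ⟨_, rfl⟩
  have hB0 : 0 ≤ B := by rw [hB]; positivity
  have hxq : ∀ n, ‖x n - q‖ ≤ B := fun n => (norm_sub_le _ _).trans (by linarith [hR n])
  obtain ⟨d, hd⟩ : ∃ d : ℕ → ℝ, d = fun n => δ n * (R + M) := ⟨_, rfl⟩
  have hd0 : ∀ n, 0 ≤ d n := fun n => by
    rw [hd]
    exact mul_nonneg (hδ n) (by linarith)
  have hdsum : Summable d := by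
    rw [hd]
    exact hδsum.mul_right _
  have hS : 0 ≤ ∑' k, d k := tsum_nonneg hd0
  have hgx : ∀ n, β n * ‖gn n (x n) - x n‖ ≤ d n := fun n => by
    rw [hd]
    exact (hgδ n _ (hxD n)).trans (mul_le_mul_of_nonneg_left (by linarith [hR n]) (hδ n))
  have hnorm : ∀ (t : ℝ) (u v : H), 0 ≤ t → t ≤ 1 →
      ‖t • u + (1 - t) • v‖ ≤ t * ‖u‖ + (1 - t) * ‖v‖ := fun t u v h0 h1 => by
    refine (norm_add_le _ _).trans_eq ?_
    rw [norm_smul, norm_smul, Real.norm_of_nonneg h0, Real.norm_of_nonneg (sub_nonneg.2 h1)]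
  have hyx : ∀ n, ‖y n - x n‖ ≤ d n + ‖T (x n) - x n‖ := fun n => by
    have h1 : y n - x n = β n • (gn n (x n) - x n) + (1 - β n) • (T (x n) - x n) := by
      rw [hyrec]
      module
    have h2 := hnorm (β n) (gn n (x n) - x n) (T (x n) - x n) (hβ n).1.le (hβ n).2
    rw [← h1] at h2
    nlinarith [hgx n, mul_nonneg (hβ n).1.le (norm_nonneg (T (x n) - x n))]
  have hyq : ∀ n, ‖T (y n) - q‖ ≤ ‖x n - q‖ + d n := fun n => by
    have h1 : y n - q = β n • (gn n (x n) - q) + (1 - β n) • (T (x n) - q) := by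
      rw [hyrec]
      module
    have h2 := hnorm (β n) (gn n (x n) - q) (T (x n) - q) (hβ n).1.le (hβ n).2
    rw [← h1] at h2
    have h3 := hTne _ (hyD n (hxD n)) _ hqD
    have h4 := hTne _ (hxD n) _ hqD
    rw [hqfix] at h3 h4
    have h5 := mul_le_mul_of_nonneg_left
      (norm_sub_le_norm_sub_add_norm_sub (gn n (x n)) (x n) q) (hβ n).1.le
    have h6 := mul_le_mul_of_nonneg_left h4 (sub_nonneg.2 (hβ n).2)
    linarith [hgx n]
  have hh : Tendsto (fun n => ‖fn n q - f q‖) atTop (𝓝 0) :=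
    tendsto_iff_norm_sub_tendsto_zero.1 (hunif.tendsto_at hqD)
  have hr : Tendsto (fun n => ‖x (n + 1) - x n‖) atTop (𝓝 0) := by
    have hlim : Tendsto (fun n => α n * (L * B + ‖fn n q - f q‖ + ‖f q - q‖ + B)
        + (d n + 2 * ‖T (x n) - x n‖)) atTop (𝓝 0) := by
      have := (hα0.mul (((hh.const_add (L * B)).add_const ‖f q - q‖).add_const B)).add
        (hdsum.tendsto_atTop_zero.add (hTx.const_mul 2))
      simpa using this
    refine squeeze_zero (fun n => norm_nonneg _) (fun n => ?_) hlim
    have h1 : x (n + 1) - x n = α n • (fn n (x n) - x n) + (1 - α n) • (T (y n) - x n) := by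
      rw [hxrec]
      module
    have h2 := hnorm (α n) (fn n (x n) - x n) (T (y n) - x n) (hα n).1 (hα n).2
    rw [← h1] at h2
    have h3 : ‖fn n (x n) - x n‖ ≤ L * B + ‖fn n q - f q‖ + ‖f q - q‖ + B := by
      have e1 := norm_sub_le_norm_sub_add_norm_sub (fn n (x n)) (fn n q) (x n)
      have e2 := norm_sub_le_norm_sub_add_norm_sub (fn n q) (f q) (x n)
      have e3 := norm_sub_le_norm_sub_add_norm_sub (f q) q (x n)
      have e4 := mul_le_mul_of_nonneg_left (hxq n) hL.1.le
      rw [norm_sub_rev q] at e3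
      linarith [hfnL n _ (hxD n) _ hqD, hxq n]
    have h4 : ‖T (y n) - x n‖ ≤ d n + 2 * ‖T (x n) - x n‖ := by
      have e1 := norm_sub_le_norm_sub_add_norm_sub (T (y n)) (T (x n)) (x n)
      linarith [hTne _ (hyD n (hxD n)) _ (hxD n), hyx n]
    have h5 := mul_le_mul_of_nonneg_left h3 (hα n).1
    have h6 := mul_nonneg (hα n).1 (norm_nonneg (T (y n) - x n))
    linarith
  have hvar' : ∀ p ∈ D, T p = p → ⟪f q - q, p - q⟫_ℝ ≤ 0 := fun p hp hTp => by
    rw [← inner_neg_neg, neg_sub, neg_sub]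
    exact hvar p hp hTp
  have hstep : ∀ n, ‖x (n + 1) - q‖ ^ 2 ≤ (1 - 2 * (1 - L) * α n) * ‖x n - q‖ ^ 2
      + α n * (α n * B ^ 2 + 2 * (L * B) * ‖x (n + 1) - x n‖ + 2 * B * ‖fn n q - f q‖
        + 2 * ⟪f q - q, x (n + 1) - q⟫_ℝ) + (2 * B + ∑' k, d k) * d n := fun n => by
    have h1 : x (n + 1) - q = α n • (fn n (x n) - q) + (1 - α n) • (T (y n) - q) := by
      rw [hxrec]
      module
    have h2 := norm_add_sq_le_norm_sq_add_inner (α n • (fn n (x n) - q))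
      ((1 - α n) • (T (y n) - q))
    rw [← h1, norm_smul, Real.norm_of_nonneg (sub_nonneg.2 (hα n).2), real_inner_smul_left,
      mul_pow] at h2
    have h3 : ⟪fn n (x n) - q, x (n + 1) - q⟫_ℝ ≤ L * ‖x n - q‖ ^ 2
        + L * B * ‖x (n + 1) - x n‖ + B * ‖fn n q - f q‖ + ⟪f q - q, x (n + 1) - q⟫_ℝ := by
      have e0 : fn n (x n) - q = (fn n (x n) - fn n q) + (fn n q - f q) + (f q - q) := by abel
      rw [e0, inner_add_left, inner_add_left]
      have e1 := real_inner_le_norm (fn n (x n) - fn n q) (x (n + 1) - q)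
      have e2 := real_inner_le_norm (fn n q - f q) (x (n + 1) - q)
      have e3 := mul_le_mul_of_nonneg_left (hxq (n + 1)) (norm_nonneg (fn n q - f q))
      have e4 := mul_le_mul_of_nonneg_right (hfnL n _ (hxD n) _ hqD)
        (norm_nonneg (x (n + 1) - q))
      have e5 := mul_le_mul_of_nonneg_left
        (norm_sub_le_norm_sub_add_norm_sub (x (n + 1)) (x n) q)
        (mul_nonneg hL.1.le (norm_nonneg (x n - q)))
      have e6 := mul_le_mul_of_nonneg_right (mul_le_mul_of_nonneg_left (hxq n) hL.1.le)
        (norm_nonneg (x (n + 1) - x n))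
      linarith
    have h4 : ‖T (y n) - q‖ ^ 2 ≤ ‖x n - q‖ ^ 2 + (2 * B + ∑' k, d k) * d n := by
      have e1 := pow_le_pow_left₀ (norm_nonneg _) (hyq n) 2
      have e2 := mul_le_mul_of_nonneg_right (hxq n) (hd0 n)
      have e3 := mul_le_mul_of_nonneg_right (hdsum.le_tsum n fun k _ => hd0 k) (hd0 n)
      linarith
    have h5 := mul_le_mul_of_nonneg_left h3 (hα n).1
    have h6 := mul_le_mul_of_nonneg_left h4 (sq_nonneg (1 - α n))
    have h7 : (1 - α n) ^ 2 * ((2 * B + ∑' k, d k) * d n) ≤ (2 * B + ∑' k, d k) * d n := by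
      refine mul_le_of_le_one_left ?_ (pow_le_one₀ (sub_nonneg.2 (hα n).2) (by linarith [(hα n).1]))
      exact mul_nonneg (by linarith) (hd0 n)
    have h8 := mul_le_mul_of_nonneg_left (pow_le_pow_left₀ (norm_nonneg _) (hxq n) 2)
      (sq_nonneg (α n))
    linarith
  have hL1 : 0 < 1 - L := sub_pos.2 hL.2
  have hsq : Tendsto (fun n => ‖x n - q‖ ^ 2) atTop (𝓝 0) := by
    refine tendsto_zero_of_le_one_sub_mul_add (γ := fun n => 2 * (1 - L) * α n)
      (c := fun n => (2 * B + ∑' k, d k) * d n) (fun n => sq_nonneg _)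
      (fun n => mul_nonneg (by linarith) (hα n).1) ?_ ?_
      (fun n => mul_nonneg (by linarith) (hd0 n)) (hdsum.mul_left _) ?_
    · have : Tendsto (fun n => 2 * (1 - L) * α n) atTop (𝓝 0) := by
        simpa using hα0.const_mul (2 * (1 - L))
      exact this.eventually_le_const one_pos
    · rwa [summable_mul_left_iff (by positivity)]
    · intro ε hε
      have hlim : Tendsto (fun n => α n * B ^ 2 + 2 * (L * B) * ‖x (n + 1) - x n‖
          + 2 * B * ‖fn n q - f q‖) atTop (𝓝 0) := by
        simpa using ((hα0.mul_const (B ^ 2)).add (hr.const_mul (2 * (L * B)))).add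
          (hh.const_mul (2 * B))
      have hin := (tendsto_add_atTop_nat 1).eventually
        (eventually_inner_lt_of_approx_fixed hDcl hDcv hTne hxD hR hTx hvar'
          (show 0 < (1 - L) * ε / 2 by positivity))
      filter_upwards [hlim.eventually_lt_const (mul_pos hL1 hε), hin] with n h1 h2
      have h3 : α n * B ^ 2 + 2 * (L * B) * ‖x (n + 1) - x n‖ + 2 * B * ‖fn n q - f q‖
        + 2 * ⟪f q - q, x (n + 1) - q⟫_ℝ ≤ 2 * (1 - L) * ε := by linarith
      linarith [hstep n, mul_le_mul_of_nonneg_left h3 (hα n).1]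
  rw [tendsto_iff_norm_sub_tendsto_zero]
  simpa [Real.sqrt_sq] using hsq.sqrt
end

section
/- Let H be a real Hilbert space, D a nonempty closed convex subset of H, and T : D → D a nonexpansive mapping with F(T) ≠ ∅. Let f : D → D be an α-contraction with α ∈ (0,1), let f_n : D → D be contractions converging uniformly on D to f, and let t_n ∈ (0,1) with t_n → 0. For each n let z_n ∈ D be the unique solution of z = t_n f_n(z) + (1 − t_n) T z. If q ∈ F(T) satisfies ⟨q − f(q), q − p⟩ ≤ 0 for all p ∈ F(T), then z_n converges strongly to q. -/
open Filter Topology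
open scoped InnerProductSpace

section ImplicitPath

variable {H : Type*} [NormedAddCommGroup H] [InnerProductSpace ℝ H]

/-- Points of the implicit path `x = s • u + (1 - s) • T x` of a nonexpansive map satisfy a
monotonicity estimate; `T x` and `T y` enter only through their values `x'` and `y'`. -/
lemma implicit_path_estimate {u x y x' y' : H} {s r : ℝ} (hs : s < 1) (hr : r < 1)
    (hx : x = s • u + (1 - s) • x') (hy : y = r • u + (1 - r) • y')
    (hne : ‖x' - y'‖ ≤ ‖x - y‖) :
    (s * (1 - r) + r * (1 - s)) * ‖x - y‖ ^ 2
      ≤ (s - r) * (‖y - u‖ ^ 2 - ‖x - u‖ ^ 2) := by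
  have hs' : 0 < 1 - s := by linarith
  have hr' : 0 < 1 - r := by linarith
  have hcomb : ((1 - s) * (1 - r)) • (x' - y')
      = (1 - r) • (x - u) - (1 - s) • (y - u) := by
    have hx1 : (1 - s) • x' = x - s • u := by rw [eq_sub_iff_add_eq, add_comm]; exact hx.symm
    have hy1 : (1 - r) • y' = y - r • u := by rw [eq_sub_iff_add_eq, add_comm]; exact hy.symm
    have : ((1 - s) * (1 - r)) • (x' - y')
        = (1 - r) • ((1 - s) • x') - (1 - s) • ((1 - r) • y') := by module
    rw [this, hx1, hy1]
    module
  have hcs : ⟪x' - y', x - y⟫_ℝ ≤ ‖x - y‖ ^ 2 := by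
    nlinarith [real_inner_le_norm (x' - y') (x - y), norm_nonneg (x - y)]
  have hxy : x - y = (x - u) - (y - u) := by abel
  have hinner : ((1 - s) * (1 - r)) * ⟪x' - y', x - y⟫_ℝ
      = (1 - r) * ‖x - u‖ ^ 2 + (1 - s) * ‖y - u‖ ^ 2
        - ((1 - r) + (1 - s)) * ⟪x - u, y - u⟫_ℝ := by
    rw [← real_inner_smul_left, hcomb, hxy]
    generalize x - u = v
    generalize y - u = v'
    simp only [inner_sub_left, inner_sub_right, real_inner_smul_left,
      real_inner_self_eq_norm_sq, real_inner_comm v v']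
    ring
  have hnorm : ‖x - y‖ ^ 2
      = ‖x - u‖ ^ 2 - 2 * ⟪x - u, y - u⟫_ℝ + ‖y - u‖ ^ 2 := by
    rw [hxy, norm_sub_sq_real]
  have := mul_le_mul_of_nonneg_left hcs (mul_pos hs' hr').le
  rw [hinner] at this
  nlinarith

/-- The implicit path is defined for all parameters in `(0, 1)`. -/
lemma exists_implicit_path_point [CompleteSpace H] {D : Set H} (hDcl : IsClosed D)
    (hDcv : Convex ℝ D) {T : H → H} (hTmaps : Set.MapsTo T D D)
    (hTne : ∀ x ∈ D, ∀ y ∈ D, ‖T x - T y‖ ≤ ‖x - y‖) {u : H} (hu : u ∈ D)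
    {s : ℝ} (hs : s ∈ Set.Ioo (0 : ℝ) 1) :
    ∃ x ∈ D, x = s • u + (1 - s) • T x := by
  have hs' : 0 ≤ 1 - s := by linarith [hs.2]
  have hmaps : Set.MapsTo (fun x => s • u + (1 - s) • T x) D D := fun x hx =>
    hDcv hu (hTmaps hx) hs.1.le hs' (by ring)
  have hcontr : ContractingWith (Real.toNNReal (1 - s)) (hmaps.restrict _ D D) := by
    refine ⟨?_, LipschitzWith.of_dist_le_mul fun x y => ?_⟩
    · rw [Real.toNNReal_lt_one]
      linarith [hs.1]
    · rw [Real.coe_toNNReal _ hs']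
      change dist (s • u + (1 - s) • T x) (s • u + (1 - s) • T y) ≤ (1 - s) * dist (x : H) y
      rw [dist_add_left, dist_smul₀, Real.norm_of_nonneg hs', dist_eq_norm, dist_eq_norm]
      exact mul_le_mul_of_nonneg_left (hTne x x.2 y y.2) hs'
  obtain ⟨x, hx, hfix, -⟩ :=
    hcontr.exists_fixedPoint' hDcl.isComplete hmaps hu (edist_ne_top _ _)
  exact ⟨x, hx, hfix.symm⟩

/-- Browder's theorem: the implicit path anchored at `u` converges to the fixed point `q`
characterized by the variational inequality. -/
lemma tendsto_implicit_path [CompleteSpace H] {D : Set H} (hDcl : IsClosed D)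
    {T : H → H}
    (hTne : ∀ x ∈ D, ∀ y ∈ D, ‖T x - T y‖ ≤ ‖x - y‖) {u : H}
    {w : ℝ → H} (hwD : ∀ s ∈ Set.Ioo (0 : ℝ) 1, w s ∈ D)
    (hw : ∀ s ∈ Set.Ioo (0 : ℝ) 1, w s = s • u + (1 - s) • T (w s))
    {q : H} (hqD : q ∈ D) (hqfix : T q = q)
    (hvar : ∀ p ∈ D, T p = p → ⟪q - u, q - p⟫_ℝ ≤ 0) :
    Tendsto w (𝓝[>] 0) (𝓝 q) := by
  have hmem : ∀ᶠ s in 𝓝[>] (0 : ℝ), s ∈ Set.Ioo (0 : ℝ) 1 := Ioo_mem_nhdsGT one_pos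
  have hbound : ∀ s ∈ Set.Ioo (0 : ℝ) 1, ‖w s - q‖ ^ 2 ≤ ‖q - u‖ ^ 2 - ‖w s - u‖ ^ 2 := by
    intro s hs
    have h := implicit_path_estimate (r := 0) hs.2 one_pos (hw s hs)
      (show q = (0 : ℝ) • u + (1 - 0 : ℝ) • T q by simp [hqfix]) (hTne _ (hwD s hs) _ hqD)
    refine le_of_mul_le_mul_left ?_ hs.1
    linarith
  have hpair : ∀ s ∈ Set.Ioo (0 : ℝ) 1, ∀ r ∈ Set.Ioo (0 : ℝ) 1,
      (s * (1 - r) + r * (1 - s)) * ‖w s - w r‖ ^ 2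
        ≤ (s - r) * (‖w r - u‖ ^ 2 - ‖w s - u‖ ^ 2) := fun s hs r hr =>
    implicit_path_estimate hs.2 hr.2 (hw s hs) (hw r hr) (hTne _ (hwD s hs) _ (hwD r hr))
  have hpos : ∀ s ∈ Set.Ioo (0 : ℝ) 1, ∀ r ∈ Set.Ioo (0 : ℝ) 1,
      0 < s * (1 - r) ∧ 0 < r * (1 - s) := fun s hs r hr =>
    ⟨mul_pos hs.1 (sub_pos.2 hr.2), mul_pos hr.1 (sub_pos.2 hs.2)⟩
  have hanti : AntitoneOn (fun s => ‖w s - u‖ ^ 2) (Set.Ioo 0 1) := by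
    intro r hr s hs hrs
    obtain rfl | hlt := hrs.eq_or_lt
    · exact le_rfl
    · have h1 := hpos s hs r hr
      have h2 : 0 ≤ (s - r) * (‖w r - u‖ ^ 2 - ‖w s - u‖ ^ 2) :=
        (mul_nonneg (by linarith) (sq_nonneg _)).trans (hpair s hs r hr)
      exact sub_nonneg.1 (nonneg_of_mul_nonneg_right h2 (sub_pos.2 hlt))
  have hsq : ∀ s ∈ Set.Ioo (0 : ℝ) 1, ∀ r ∈ Set.Ioo (0 : ℝ) 1,
      ‖w s - w r‖ ^ 2 ≤ dist (‖w s - u‖ ^ 2) (‖w r - u‖ ^ 2) := by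
    intro s hs r hr
    have h1 := hpos s hs r hr
    rw [dist_comm, Real.dist_eq]
    refine le_of_mul_le_mul_left ((hpair s hs r hr).trans ((le_abs_self _).trans ?_))
      (add_pos h1.1 h1.2)
    rw [abs_mul]
    refine mul_le_mul_of_nonneg_right (abs_le.2 ⟨?_, ?_⟩) (abs_nonneg _) <;> linarith
  have hbdd : BddAbove ((fun s => ‖w s - u‖ ^ 2) '' Set.Ioo 0 1) := by
    refine ⟨‖q - u‖ ^ 2, ?_⟩
    rintro _ ⟨s, hs, rfl⟩
    change ‖w s - u‖ ^ 2 ≤ _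
    linarith [hbound s hs, sq_nonneg ‖w s - q‖]
  have hcauchy : Cauchy (map w (𝓝[>] 0)) := by
    have hg := (hanti.tendsto_nhdsWithin_Ioo_right (Set.nonempty_Ioo.2 one_pos) hbdd).cauchy_map
    rw [cauchy_map_iff, tendsto_uniformity_iff_dist_tendsto_zero] at hg ⊢
    refine ⟨inferInstance, ?_⟩
    have hsqrt := hg.2.sqrt
    rw [Real.sqrt_zero] at hsqrt
    refine squeeze_zero' (Eventually.of_forall fun _ => dist_nonneg) ?_ hsqrt
    filter_upwards [hmem.prod_mk hmem] with p hp
    rw [dist_eq_norm]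
    exact Real.le_sqrt_of_sq_le (hsq _ hp.1 _ hp.2)
  obtain ⟨v, hv⟩ := CompleteSpace.complete hcauchy
  have hv : Tendsto w (𝓝[>] 0) (𝓝 v) := hv
  have hid : Tendsto (fun s : ℝ => s) (𝓝[>] 0) (𝓝 0) :=
    tendsto_nhdsWithin_of_tendsto_nhds tendsto_id
  have hvD : v ∈ D := hDcl.mem_of_tendsto hv (hmem.mono hwD)
  have hTv : Tendsto (fun s => T (w s)) (𝓝[>] 0) (𝓝 (T v)) := by
    rw [tendsto_iff_norm_sub_tendsto_zero] at hv ⊢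
    exact squeeze_zero' (Eventually.of_forall fun _ => norm_nonneg _)
      (hmem.mono fun s hs => hTne _ (hwD s hs) _ hvD) hv
  have hvfix : T v = v := by
    have hlim : Tendsto (fun s : ℝ => s • u + (1 - s) • T (w s)) (𝓝[>] 0)
        (𝓝 ((0 : ℝ) • u + (1 - 0 : ℝ) • T v)) :=
      (hid.smul_const u).add ((hid.const_sub 1).smul hTv)
    have := tendsto_nhds_unique (hv.congr' (hmem.mono hw)) hlim
    simpa using this.symm
  have hvbound : ‖v - q‖ ^ 2 ≤ ‖q - u‖ ^ 2 - ‖v - u‖ ^ 2 :=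
    le_of_tendsto_of_tendsto ((hv.sub_const q).norm.pow 2)
      (((hv.sub_const u).norm.pow 2).const_sub _) (hmem.mono hbound)
  have hexp : ‖v - u‖ ^ 2 = ‖q - u‖ ^ 2 - 2 * ⟪q - u, q - v⟫_ℝ + ‖q - v‖ ^ 2 := by
    rw [← norm_sub_sq_real]
    congr 2
    abel
  rw [norm_sub_rev q v] at hexp
  have hzero : ‖v - q‖ ^ 2 = 0 :=
    le_antisymm (by linarith [hvar v hvD hvfix]) (sq_nonneg _)
  have hvq : v = q := by simpa [sub_eq_zero] using hzero
  exact hvq ▸ hv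

end ImplicitPath

/-- Lemma 2.1 of the paper, in the Hilbert-space setting. -/
theorem approximating_paths_converge
    {H : Type*} [NormedAddCommGroup H] [InnerProductSpace ℝ H] [CompleteSpace H]
    (D : Set H) (hDne : D.Nonempty) (hDcl : IsClosed D) (hDcv : Convex ℝ D)
    (T : H → H) (hTmaps : Set.MapsTo T D D)
    (hTne : ∀ x ∈ D, ∀ y ∈ D, ‖T x - T y‖ ≤ ‖x - y‖)
    (hFne : ∃ p ∈ D, T p = p)
    (f : H → H) (hfmaps : Set.MapsTo f D D)
    (a : ℝ) (ha : a ∈ Set.Ioo (0 : ℝ) 1)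
    (hf : ∀ x ∈ D, ∀ y ∈ D, ‖f x - f y‖ ≤ a * ‖x - y‖)
    (fn : ℕ → H → H) (hfnmaps : ∀ n, Set.MapsTo (fn n) D D)
    (hfn : ∀ n, ∃ c ∈ Set.Ioo (0 : ℝ) 1, ∀ x ∈ D, ∀ y ∈ D, ‖fn n x - fn n y‖ ≤ c * ‖x - y‖)
    (hunif : TendstoUniformlyOn fn f atTop D)
    (t : ℕ → ℝ) (ht : ∀ n, t n ∈ Set.Ioo (0 : ℝ) 1)
    (ht0 : Tendsto t atTop (𝓝 0))
    (z : ℕ → H) (hz : ∀ n, z n ∈ D)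
    (hzfix : ∀ n, z n = t n • fn n (z n) + (1 - t n) • T (z n))
    (q : H) (hqD : q ∈ D) (hqfix : T q = q)
    (hvar : ∀ p ∈ D, T p = p → ⟪q - f q, q - p⟫_ℝ ≤ 0) :
    Tendsto z atTop (𝓝 q) := by
  have hfq : f q ∈ D := hfmaps hqD
  choose! w hwD hw using fun s (hs : s ∈ Set.Ioo (0 : ℝ) 1) =>
    exists_implicit_path_point hDcl hDcv hTmaps hTne hfq hs
  have hwt : Tendsto (fun n => w (t n)) atTop (𝓝 q) :=
    (tendsto_implicit_path hDcl hTne hwD hw hqD hqfix hvar).comp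
      (tendsto_nhdsWithin_iff.2 ⟨ht0, Eventually.of_forall fun n => (ht n).1⟩)
  have hfz : Tendsto (fun n => ‖fn n (z n) - f (z n)‖) atTop (𝓝 0) := by
    rw [Metric.tendsto_atTop]
    intro ε hε
    obtain ⟨N, hN⟩ := eventually_atTop.1 (Metric.tendstoUniformlyOn_iff.1 hunif ε hε)
    refine ⟨N, fun n hn => ?_⟩
    have := hN n hn (z n) (hz n)
    rwa [dist_zero_right, norm_norm, ← dist_eq_norm, dist_comm]
  have hkey : ∀ n, ‖z n - q‖ ≤ (‖fn n (z n) - f (z n)‖ + ‖w (t n) - q‖) / (1 - a) := by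
    intro n
    have htn := ht n
    have hdiff : z n - w (t n)
        = t n • (fn n (z n) - f q) + (1 - t n) • (T (z n) - T (w (t n))) := by
      conv_lhs => rw [hzfix n, hw (t n) htn]
      module
    have h1 : ‖z n - w (t n)‖
        ≤ t n * ‖fn n (z n) - f q‖ + (1 - t n) * ‖z n - w (t n)‖ := by
      conv_lhs => rw [hdiff]
      refine (norm_add_le _ _).trans ?_
      rw [norm_smul, norm_smul, Real.norm_of_nonneg htn.1.le,
        Real.norm_of_nonneg (sub_nonneg.2 htn.2.le)]
      gcongr
      · exact sub_nonneg.2 htn.2.le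
      · exact hTne _ (hz n) _ (hwD _ htn)
    have h2 : ‖z n - w (t n)‖ ≤ ‖fn n (z n) - f q‖ :=
      le_of_mul_le_mul_left (by linarith) htn.1
    have h3 := norm_sub_le_norm_sub_add_norm_sub (fn n (z n)) (f (z n)) (f q)
    have h4 := hf _ (hz n) _ hqD
    have h5 := norm_sub_le_norm_sub_add_norm_sub (z n) (w (t n)) q
    rw [le_div_iff₀ (sub_pos.2 ha.2)]
    linarith
  rw [tendsto_iff_norm_sub_tendsto_zero] at hwt ⊢
  refine squeeze_zero (fun n => norm_nonneg _) hkey ?_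
  simpa using (hfz.add hwt).div_const (1 - a)
end

section
/- Let H be a real Hilbert space, D a nonempty closed convex subset of H, and T : D → D a nonexpansive mapping with F(T) ≠ ∅. Let f : D → D be a contraction, x_0 ∈ D, and define x_{n+1} = α_n f(x_n) + (1 − α_n) T x_n, where α_n ∈ [0,1], α_n → 0, and ∑_{n=0}^∞ α_n = ∞. Assume {x_n} is bounded and ‖T x_n − x_n‖ → 0. If q ∈ F(T) satisfies ⟨q − f(q), q − p⟩ ≤ 0 for all p ∈ F(T), then {x_n} converges strongly to q. -/
open Filter Topology
open scoped InnerProductSpace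

section WeakLimits

variable {H : Type*} [NormedAddCommGroup H] [InnerProductSpace ℝ H]

/-- A bounded family in a Hilbert space converges weakly along every ultrafilter. -/
theorem exists_tendsto_inner_of_bounded [CompleteSpace H] {ι : Type*} (U : Ultrafilter ι)
    {x : ι → H} {M : ℝ} (hM : ∀ i, ‖x i‖ ≤ M) :
    ∃ p : H, ∀ y : H, Tendsto (fun i => ⟪x i, y⟫_ℝ) U (𝓝 ⟪p, y⟫_ℝ) := by
  let φ : ι → WeakDual ℝ H := fun i =>
    StrongDual.toWeakDual (InnerProductSpace.toDual ℝ H (x i))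
  have hc : IsCompact (WeakDual.toStrongDual ⁻¹'
      Metric.closedBall (0 : StrongDual ℝ H) M : Set (WeakDual ℝ H)) :=
    WeakDual.isCompact_closedBall 0 M
  obtain ⟨ℓ, -, hℓ⟩ := hc.ultrafilter_le_nhds (U.map φ) (by
    rw [le_principal_iff, Ultrafilter.mem_coe, Ultrafilter.mem_map]
    refine Filter.univ_mem' fun i => ?_
    change InnerProductSpace.toDual ℝ H (x i) ∈ Metric.closedBall (0 : StrongDual ℝ H) M
    simpa using hM i)
  refine ⟨(InnerProductSpace.toDual ℝ H).symm (WeakDual.toStrongDual ℓ), fun y => ?_⟩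
  rw [InnerProductSpace.toDual_symm_apply]
  have hφ : Tendsto φ U (𝓝 ℓ) := hℓ
  exact ((WeakDual.eval_continuous y).tendsto ℓ).comp hφ

/-- A closed convex set contains the weak limits of its points. -/
theorem IsClosed.mem_of_tendsto_inner [CompleteSpace H] {ι : Type*} {l : Filter ι} [l.NeBot]
    {D : Set H} (hDcl : IsClosed D) (hDne : D.Nonempty) (hDcv : Convex ℝ D) {x : ι → H}
    (hx : ∀ i, x i ∈ D) {p : H} (hp : ∀ y : H, Tendsto (fun i => ⟪x i, y⟫_ℝ) l (𝓝 ⟪p, y⟫_ℝ)) :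
    p ∈ D := by
  obtain ⟨v, hvD, hv⟩ := exists_norm_eq_iInf_of_complete_convex hDne hDcl.isComplete hDcv p
  rw [norm_eq_iInf_iff_real_inner_le_zero hDcv hvD] at hv
  have hlim := (hp (p - v)).sub_const ⟪v, p - v⟫_ℝ
  have hle : ⟪p, p - v⟫_ℝ - ⟪v, p - v⟫_ℝ ≤ 0 := le_of_tendsto hlim <|
    Eventually.of_forall fun i => by
      rw [← inner_sub_left, real_inner_comm]
      exact hv _ (hx i)
  rw [← inner_sub_left, real_inner_self_nonpos, sub_eq_zero] at hle
  exact hle ▸ hvD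

/-- Demiclosedness principle: a weak limit of approximate fixed points of a nonexpansive mapping
is a fixed point. -/
theorem fixed_of_tendsto_inner_of_nonexpansive {ι : Type*} {l : Filter ι} [l.NeBot] {D : Set H}
    {T : H → H} (hT : ∀ x ∈ D, ∀ y ∈ D, ‖T x - T y‖ ≤ ‖x - y‖) {x : ι → H} (hx : ∀ i, x i ∈ D)
    {M : ℝ} (hM : ∀ i, ‖x i‖ ≤ M) (hTx : Tendsto (fun i => ‖T (x i) - x i‖) l (𝓝 0))
    {p : H} (hpD : p ∈ D) (hp : ∀ y : H, Tendsto (fun i => ⟪x i, y⟫_ℝ) l (𝓝 ⟪p, y⟫_ℝ)) :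
    T p = p := by
  have hlim : Tendsto (fun i => ‖T (x i) - x i‖ * (‖T (x i) - x i‖ + 2 * (M + ‖p‖))
      - 2 * (⟪x i, p - T p⟫_ℝ - ⟪p, p - T p⟫_ℝ)) l (𝓝 0) := by
    simpa using (hTx.mul (hTx.add_const (2 * (M + ‖p‖)))).sub
      (((hp (p - T p)).sub_const ⟪p, p - T p⟫_ℝ).const_mul 2)
  have hle : ‖p - T p‖ ^ 2 ≤ 0 := ge_of_tendsto hlim <| Eventually.of_forall fun i => by
    have hexp := norm_add_sq_real (x i - p) (p - T p)
    rw [sub_add_sub_cancel, inner_sub_left] at hexp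
    have htri : ‖x i - T p‖ ≤ ‖T (x i) - x i‖ + ‖x i - p‖ := by
      have h := norm_sub_le_norm_sub_add_norm_sub (x i) (T (x i)) (T p)
      rw [norm_sub_rev (x i) (T (x i))] at h
      linarith [hT _ (hx i) _ hpD]
    have hbd : ‖x i - p‖ ≤ M + ‖p‖ := (norm_sub_le _ _).trans (by linarith [hM i])
    have hsq := pow_le_pow_left₀ (norm_nonneg _) htri 2
    have hmul := mul_le_mul_of_nonneg_left hbd (norm_nonneg (T (x i) - x i))
    nlinarith
  have h0 : ‖p - T p‖ = 0 := pow_eq_zero_iff two_ne_zero |>.1 (le_antisymm hle (sq_nonneg _))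
  exact (sub_eq_zero.1 (norm_eq_zero.1 h0)).symm

/-- Approximate fixed points of a nonexpansive mapping asymptotically satisfy any upper bound that
a linear functional satisfies on the fixed points. -/
theorem eventually_inner_lt_of_nonexpansive [CompleteSpace H] {ι : Type*} {l : Filter ι} {D : Set H}
    (hDcl : IsClosed D) (hDne : D.Nonempty) (hDcv : Convex ℝ D)
    {T : H → H} (hT : ∀ x ∈ D, ∀ y ∈ D, ‖T x - T y‖ ≤ ‖x - y‖) {x : ι → H} (hx : ∀ i, x i ∈ D)
    {M : ℝ} (hM : ∀ i, ‖x i‖ ≤ M) (hTx : Tendsto (fun i => ‖T (x i) - x i‖) l (𝓝 0))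
    {y : H} {c d : ℝ} (hc : ∀ p ∈ D, T p = p → ⟪p, y⟫_ℝ ≤ c) (hcd : c < d) :
    ∀ᶠ i in l, ⟪x i, y⟫_ℝ < d := by
  by_contra hcon
  rw [not_eventually, frequently_iff_neBot] at hcon
  let U := Ultrafilter.of (l ⊓ 𝓟 {i | ¬ ⟪x i, y⟫_ℝ < d})
  have hU : (U : Filter ι) ≤ l ⊓ 𝓟 {i | ¬ ⟪x i, y⟫_ℝ < d} := Ultrafilter.of_le _
  obtain ⟨p, hp⟩ := exists_tendsto_inner_of_bounded U hM
  have hpD := hDcl.mem_of_tendsto_inner hDne hDcv hx hp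
  have hpT := fixed_of_tendsto_inner_of_nonexpansive hT hx hM
    (hTx.mono_left (hU.trans inf_le_left)) hpD hp
  have hge : d ≤ ⟪p, y⟫_ℝ := ge_of_tendsto (hp y) <| by
    filter_upwards [le_principal_iff.1 (hU.trans inf_le_right)] with i hi
    exact not_lt.1 hi
  linarith [hc p hpD hpT]

end WeakLimits

/-- A real sequence that is eventually averaged with `δ`, with weights of divergent sum, is
eventually below any number greater than `δ`. -/
theorem eventually_lt_of_le_averaged {s b : ℕ → ℝ} {δ ε : ℝ} (hδε : δ < ε)
    (hb : ∀ n, b n ∈ Set.Icc (0 : ℝ) 1) (hdiv : ¬ Summable b)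
    (hs : ∀ᶠ n in atTop, s (n + 1) ≤ (1 - b n) * s n + b n * δ) :
    ∀ᶠ n in atTop, s n < ε := by
  obtain ⟨N, hN⟩ := eventually_atTop.1 hs
  have hbound (k : ℕ) : s (k + N) - δ ≤
      Real.exp (-∑ i ∈ Finset.range k, b (i + N)) * |s N - δ| := by
    induction k with
    | zero => simpa using le_abs_self (s N - δ)
    | succ k ih =>
      have hstep := hN (k + N) (Nat.le_add_left N k)
      have h1 : 0 ≤ 1 - b (k + N) := sub_nonneg.2 (hb _).2
      rw [Finset.sum_range_succ, neg_add, Real.exp_add, add_right_comm]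
      calc s (k + N + 1) - δ ≤ (1 - b (k + N)) * (s (k + N) - δ) := by linarith
        _ ≤ (1 - b (k + N)) *
            (Real.exp (-∑ i ∈ Finset.range k, b (i + N)) * |s N - δ|) := by gcongr
        _ ≤ Real.exp (-b (k + N)) *
            (Real.exp (-∑ i ∈ Finset.range k, b (i + N)) * |s N - δ|) := by
          gcongr
          exact Real.one_sub_le_exp_neg _
        _ = _ := by ring
  have hsum : Tendsto (fun k => ∑ i ∈ Finset.range k, b (i + N)) atTop atTop :=
    (not_summable_iff_tendsto_nat_atTop_of_nonneg fun i => (hb (i + N)).1).1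
      (mt (summable_nat_add_iff N).1 hdiv)
  have hlim : Tendsto (fun k => Real.exp (-∑ i ∈ Finset.range k, b (i + N)) * |s N - δ|)
      atTop (𝓝 0) := by
    simpa using (Real.tendsto_exp_neg_atTop_nhds_zero.comp hsum).mul_const |s N - δ|
  rw [← map_add_atTop_eq_nat N, eventually_map]
  filter_upwards [hlim.eventually_lt_const (sub_pos.2 hδε)] with k hk
  linarith [hbound k]

/-- One step of the viscosity iteration, measured from a fixed point `q` of `T`. -/
theorem norm_sq_viscosity_step_le {H : Type*} [NormedAddCommGroup H] [InnerProductSpace ℝ H]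
    {u v q g : H} {a t d : ℝ} (ha : a ∈ Set.Icc (0 : ℝ) 1) (ht : t ∈ Set.Icc (0 : ℝ) 1)
    (hu : ‖u - g‖ ≤ a * d) (hv : ‖v - q‖ ≤ d) :
    ‖t • u + (1 - t) • v - q‖ ^ 2 ≤ (1 - t * (1 - a)) * d ^ 2
      + 2 * t * ⟪g - q, t • u + (1 - t) • v - q⟫_ℝ := by
  obtain ⟨ha0, ha1⟩ := ha
  obtain ⟨ht0, ht1⟩ := ht
  have hd : 0 ≤ d := (norm_nonneg _).trans hv
  set z := t • u + (1 - t) • v - q with hz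
  set w := t • (u - g) + (1 - t) • (v - q) with hw
  have hzw : w = z - t • (g - q) := by rw [hz, hw]; module
  have hwn : ‖w‖ ≤ (1 - t * (1 - a)) * d := by
    have h := norm_add_le (t • (u - g)) ((1 - t) • (v - q))
    rw [norm_smul, norm_smul, Real.norm_of_nonneg ht0,
      Real.norm_of_nonneg (sub_nonneg.2 ht1)] at h
    have h1 := mul_le_mul_of_nonneg_left hu ht0
    have h2 := mul_le_mul_of_nonneg_left hv (sub_nonneg.2 ht1)
    linarith
  have hk0 : 0 ≤ 1 - t * (1 - a) := by nlinarith
  have hk1 : 1 - t * (1 - a) ≤ 1 := by nlinarith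
  have hsq : ‖w‖ ^ 2 ≤ (1 - t * (1 - a)) * d ^ 2 :=
    calc ‖w‖ ^ 2 ≤ ((1 - t * (1 - a)) * d) ^ 2 := pow_le_pow_left₀ (norm_nonneg _) hwn 2
      _ = (1 - t * (1 - a)) ^ 2 * d ^ 2 := mul_pow _ _ _
      _ ≤ (1 - t * (1 - a)) * d ^ 2 := by
        gcongr
        exact pow_le_of_le_one hk0 hk1 two_ne_zero
  have hexp := norm_sub_sq_real z (t • (g - q))
  rw [← hzw, inner_smul_right, real_inner_comm] at hexp
  linarith [sq_nonneg ‖t • (g - q)‖]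

/-- Theorem 3.1 of the paper (viscosity approximation), in the Hilbert-space setting. -/
theorem viscosity_iteration_converges
    {H : Type*} [NormedAddCommGroup H] [InnerProductSpace ℝ H] [CompleteSpace H]
    (D : Set H) (hDne : D.Nonempty) (hDcl : IsClosed D) (hDcv : Convex ℝ D)
    (T : H → H) (hTmaps : Set.MapsTo T D D)
    (hTne : ∀ x ∈ D, ∀ y ∈ D, ‖T x - T y‖ ≤ ‖x - y‖)
    (hFne : ∃ p ∈ D, T p = p)
    (f : H → H) (hfmaps : Set.MapsTo f D D)
    (a : ℝ) (ha : a ∈ Set.Ioo (0 : ℝ) 1)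
    (hf : ∀ x ∈ D, ∀ y ∈ D, ‖f x - f y‖ ≤ a * ‖x - y‖)
    (α : ℕ → ℝ) (hα : ∀ n, α n ∈ Set.Icc (0 : ℝ) 1)
    (hα0 : Tendsto α atTop (𝓝 0))
    (hαdiv : ¬ Summable α)
    (x : ℕ → H) (hx0 : x 0 ∈ D)
    (hxrec : ∀ n, x (n + 1) = α n • f (x n) + (1 - α n) • T (x n))
    (hxbdd : Bornology.IsBounded (Set.range x))
    (hTx : Tendsto (fun n => ‖T (x n) - x n‖) atTop (𝓝 0))
    (q : H) (hqD : q ∈ D) (hqfix : T q = q)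
    (hvar : ∀ p ∈ D, T p = p → ⟪q - f q, q - p⟫_ℝ ≤ 0) :
    Tendsto x atTop (𝓝 q) := by
  obtain ⟨ha0, ha1⟩ := ha
  have hxD (n : ℕ) : x n ∈ D := by
    induction n with
    | zero => exact hx0
    | succ n ih =>
      rw [hxrec]
      exact hDcv (hfmaps ih) (hTmaps ih) (hα n).1 (sub_nonneg.2 (hα n).2) (by ring)
  obtain ⟨M, hM⟩ := hxbdd.exists_norm_le
  have hTq (n : ℕ) : ‖T (x n) - q‖ ≤ ‖x n - q‖ := by
    simpa only [hqfix] using hTne _ (hxD n) _ hqD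
  have hstep (n : ℕ) := norm_sq_viscosity_step_le (q := q) (g := f q) ⟨ha0.le, ha1.le⟩ (hα n)
    (hf _ (hxD n) _ hqD) (hTq n)
  simp_rw [← hxrec] at hstep
  have hsq : Tendsto (fun n => ‖x n - q‖ ^ 2) atTop (𝓝 0) := by
    refine tendsto_order.2 ⟨fun c hc => Eventually.of_forall fun n => hc.trans_le (sq_nonneg _),
      fun ε hε => ?_⟩
    have hev : ∀ᶠ n in atTop, ⟪x n, f q - q⟫_ℝ < ⟪q, f q - q⟫_ℝ + (1 - a) * ε / 4 := by
      refine eventually_inner_lt_of_nonexpansive hDcl hDne hDcv hTne hxD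
        (fun n => hM _ (Set.mem_range_self n)) hTx (c := ⟪q, f q - q⟫_ℝ) (fun p hpD hpT => ?_) ?_
      · have h := hvar p hpD hpT
        rw [← neg_sub (f q) q, inner_neg_left, real_inner_comm, inner_sub_left] at h
        linarith
      · have := mul_pos (sub_pos.2 ha1) hε
        linarith
    refine eventually_lt_of_le_averaged (b := fun n => α n * (1 - a)) (half_lt_self hε)
      (fun n => ⟨mul_nonneg (hα n).1 (sub_nonneg.2 ha1.le),
        mul_le_one₀ (hα n).2 (sub_nonneg.2 ha1.le) (sub_le_self 1 ha0.le)⟩)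
      (by rwa [summable_mul_right_iff (sub_pos.2 ha1).ne']) ?_
    filter_upwards [(tendsto_add_atTop_nat 1).eventually hev] with n hn
    have h := hstep n
    rw [real_inner_comm, inner_sub_left] at h
    have hmul := mul_le_mul_of_nonneg_left hn.le (hα n).1
    linarith
  rw [tendsto_iff_norm_sub_tendsto_zero]
  simpa using hsq.sqrt
end

section
/- Let H be a real Hilbert space, D a nonempty closed convex subset of H, and T : D → D a nonexpansive mapping with F(T) ≠ ∅. Let x_0, u ∈ D, let {u_n} and {v_n} be bounded sequences in D, and let α_n, γ_n, β_n, δ_n ≥ 0 satisfy 0 ≤ α_n + γ_n ≤ 1, 0 < β_n + δ_n ≤ 1, α_n → 0, ∑_{n=0}^∞ α_n = ∞, ∑_{n=0}^∞ γ_n < ∞, ∑_{n=0}^∞ δ_n < ∞, and γ_n/(α_n + γ_n) → 0. Define the modified Ishikawa iterative process with errors: x_{n+1} = α_n u + (1 − α_n − γ_n) T y_n + γ_n u_n, y_n = β_n x_n + (1 − β_n − δ_n) T x_n + δ_n v_n. Assume {x_n} is bounded and ‖T x_n − x_n‖ → 0. Then {x_n} converges strongly to the point q ∈ F(T) satisfying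 ⟨q − u, q − p⟩ ≤ 0 for all p ∈ F(T) (i.e., the metric projection of u onto F(T)). -/
open Filter Topology
open scoped InnerProductSpace

theorem Convex.add_smul_three_mem {E : Type*} [AddCommGroup E] [Module ℝ E] {D : Set E}
    (hD : Convex ℝ D) {x y z : E} (hx : x ∈ D) (hy : y ∈ D) (hz : z ∈ D) {a b c : ℝ}
    (ha : 0 ≤ a) (hb : 0 ≤ b) (hc : 0 ≤ c) (habc : a + b + c = 1) :
    a • x + b • y + c • z ∈ D := by
  have h := hD.sum_mem (t := Finset.univ) (w := ![a, b, c]) (z := ![x, y, z])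
    (by intro i _; fin_cases i <;> simpa) (by simpa [Fin.sum_univ_three] using habc)
    (by intro i _; fin_cases i <;> simpa)
  simpa [Fin.sum_univ_three] using h

theorem norm_add_smul_three_sq_le {E : Type*} [SeminormedAddCommGroup E] [NormedSpace ℝ E]
    (x y z : E) {a b c : ℝ} (ha : 0 ≤ a) (hb : 0 ≤ b) (hc : 0 ≤ c) (habc : a + b + c = 1) :
    ‖a • x + b • y + c • z‖ ^ 2 ≤ a * ‖x‖ ^ 2 + b * ‖y‖ ^ 2 + c * ‖z‖ ^ 2 := by
  have h : ‖a • x + b • y + c • z‖ ≤ a * ‖x‖ + b * ‖y‖ + c * ‖z‖ := by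
    refine norm_add₃_le.trans_eq ?_
    simp [norm_smul, abs_of_nonneg, ha, hb, hc]
  refine (pow_le_pow_left₀ (norm_nonneg _) h 2).trans ?_
  obtain rfl : a = 1 - b - c := by linarith
  nlinarith [mul_nonneg (mul_nonneg ha hb) (sq_nonneg (‖x‖ - ‖y‖)),
    mul_nonneg (mul_nonneg ha hc) (sq_nonneg (‖x‖ - ‖z‖)),
    mul_nonneg (mul_nonneg hb hc) (sq_nonneg (‖y‖ - ‖z‖))]

/-- A nonnegative sequence that contracts with non-summable rates, up to a summable error,
tends to zero. -/
theorem tendsto_zero_of_le_one_sub_mul_add_s3 {s α d : ℕ → ℝ} (hs : ∀ n, 0 ≤ s n)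
    (hα : ∀ n, 0 ≤ α n) (hαdiv : ¬ Summable α) (hd : ∀ n, 0 ≤ d n) (hdsum : Summable d)
    (hrec : ∀ n, s (n + 1) ≤ (1 - α n) * s n + d n) : Tendsto s atTop (𝓝 0) := by
  have hdle : ∀ n, ∑ k ∈ Finset.range n, d k ≤ ∑' k, d k := fun n =>
    hdsum.sum_le_tsum _ fun k _ => hd k
  have hsum : Summable fun n => α n * s n := by
    refine summable_of_sum_range_le (c := s 0 + ∑' k, d k)
      (fun n => mul_nonneg (hα n) (hs n)) fun n => ?_
    have h : ∑ k ∈ Finset.range n, α k * s k + s n ≤ s 0 + ∑ k ∈ Finset.range n, d k := by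
      induction n with
      | zero => simp
      | succ n ih =>
        rw [Finset.sum_range_succ, Finset.sum_range_succ]
        linarith [hrec n]
    linarith [hdle n, hs n]
  have hanti : Antitone fun n => s n - ∑ k ∈ Finset.range n, d k := by
    refine antitone_nat_of_succ_le fun n => ?_
    rw [Finset.sum_range_succ]
    linarith [hrec n, mul_nonneg (hα n) (hs n)]
  have hbdd : BddBelow (Set.range fun n => s n - ∑ k ∈ Finset.range n, d k) := by
    refine ⟨-∑' k, d k, ?_⟩
    rintro _ ⟨n, rfl⟩
    linarith [hdle n, hs n]
  obtain ⟨L, hL⟩ : ∃ L, Tendsto s atTop (𝓝 L) :=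
    ⟨_, ((tendsto_atTop_ciInf hanti hbdd).add hdsum.hasSum.tendsto_sum_nat).congr
      fun n => by ring⟩
  have hL0 : 0 ≤ L := ge_of_tendsto' hL hs
  rcases hL0.eq_or_lt with rfl | hpos
  · exact hL
  refine absurd ?_ hαdiv
  have hev : ∀ᶠ n in atTop, L / 2 < s n := hL.eventually_const_lt (by linarith)
  refine Summable.of_norm_bounded_eventually_nat (hsum.mul_left (2 / L)) ?_
  filter_upwards [hev] with n hn
  rw [Real.norm_of_nonneg (hα n), div_mul_eq_mul_div, le_div_iff₀ hpos]
  nlinarith [mul_le_mul_of_nonneg_left hn.le (hα n)]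

/-- Xu's lemma on real recursive inequalities. -/
theorem tendsto_zero_of_le_one_sub_mul_add_mul_add {a α c d : ℕ → ℝ} (ha : ∀ n, 0 ≤ a n)
    (hα : ∀ n, 0 ≤ α n) (hα1 : ∀ n, α n ≤ 1) (hαdiv : ¬ Summable α) (hd : ∀ n, 0 ≤ d n)
    (hdsum : Summable d) (hc : ∀ ε > 0, ∀ᶠ n in atTop, c n ≤ ε)
    (hrec : ∀ n, a (n + 1) ≤ (1 - α n) * a n + α n * c n + d n) : Tendsto a atTop (𝓝 0) := by
  refine tendsto_order.2 ⟨fun b hb => .of_forall fun n => hb.trans_le (ha n), fun ε hε => ?_⟩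
  obtain ⟨N, hN⟩ := eventually_atTop.1 (hc (ε / 2) (half_pos hε))
  have h := tendsto_zero_of_le_one_sub_mul_add_s3 (s := fun n => max (a (n + N) - ε / 2) 0)
    (α := fun n => α (n + N)) (d := fun n => d (n + N)) (fun n => le_max_right _ _)
    (fun n => hα _) (fun h => hαdiv ((summable_nat_add_iff N).1 h)) (fun n => hd _)
    ((summable_nat_add_iff N).2 hdsum) fun n => by
      have h1 : 0 ≤ 1 - α (n + N) := sub_nonneg.2 (hα1 _)
      refine max_le ?_ (add_nonneg (mul_nonneg h1 (le_max_right _ _)) (hd _))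
      have h2 := hrec (n + N)
      rw [show n + 1 + N = n + N + 1 by ring]
      nlinarith [mul_le_mul_of_nonneg_left (hN (n + N) (by lia)) (hα (n + N)),
        mul_le_mul_of_nonneg_left (le_max_left (a (n + N) - ε / 2) 0) h1]
  have h' : Tendsto (fun n => max (a n - ε / 2) 0) atTop (𝓝 0) :=
    (tendsto_add_atTop_iff_nat N).1 h
  filter_upwards [h'.eventually_lt_const (half_pos hε)] with n hn
  linarith [le_max_left (a n - ε / 2) 0]

section Nonexpansive

variable {H : Type*} [NormedAddCommGroup H] [InnerProductSpace ℝ H] {D : Set H} {T : H → H}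

theorem inner_sub_map_sub_nonneg (hT : ∀ x ∈ D, ∀ y ∈ D, ‖T x - T y‖ ≤ ‖x - y‖)
    {x y : H} (hx : x ∈ D) (hy : y ∈ D) : 0 ≤ ⟪(x - T x) - (y - T y), x - y⟫_ℝ := by
  have h : (x - T x) - (y - T y) = (x - y) - (T x - T y) := by abel
  rw [h, inner_sub_left, real_inner_self_eq_norm_sq]
  nlinarith [real_inner_le_norm (T x - T y) (x - y), hT x hx y hy, norm_nonneg (x - y)]

theorem exists_sub_map_eq_smul [CompleteSpace H] (hDcl : IsClosed D) (hDcv : Convex ℝ D)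
    (hTmaps : Set.MapsTo T D D) (hT : ∀ x ∈ D, ∀ y ∈ D, ‖T x - T y‖ ≤ ‖x - y‖)
    {u : H} (hu : u ∈ D) {r : ℝ} (hr : 0 < r) : ∃ z ∈ D, z - T z = r • (u - z) := by
  have : CompleteSpace D := hDcl.completeSpace_coe
  have : Nonempty D := ⟨⟨u, hu⟩⟩
  have hr1 : 0 < 1 + r := by linarith
  let c : NNReal := ⟨1 / (1 + r), by positivity⟩
  have hc : (c : ℝ) = 1 / (1 + r) := rfl
  let f : D → D := fun x => ⟨(1 / (1 + r)) • T x + (r / (1 + r)) • u,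
    hDcv (hTmaps x.2) hu (by positivity) (by positivity) (by field_simp)⟩
  have hf : ContractingWith c f := by
    refine ⟨?_, LipschitzWith.of_dist_le_mul fun x y => ?_⟩
    · rw [← NNReal.coe_lt_coe, hc, NNReal.coe_one, div_lt_one hr1]
      linarith
    · rw [Subtype.dist_eq, Subtype.dist_eq, dist_eq_norm, dist_eq_norm, hc]
      have h : ((f x : H) - f y) = (1 / (1 + r)) • (T x - T y) := by
        simp only [f, smul_sub]
        abel
      rw [h, norm_smul, Real.norm_of_nonneg (by positivity)]
      exact mul_le_mul_of_nonneg_left (hT x x.2 y y.2) (by positivity)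
  obtain ⟨z, hz⟩ : ∃ z, f z = z := ⟨_, hf.fixedPoint_isFixedPt⟩
  refine ⟨z, z.2, ?_⟩
  have h : (1 / (1 + r)) • T z + (r / (1 + r)) • u = (z : H) := congrArg Subtype.val hz
  have h2 : T z + r • u = (1 + r) • (z : H) := by
    refine Eq.trans ?_ (congrArg ((1 + r) • ·) h)
    simp only [smul_add, smul_smul, mul_div_cancel₀ _ hr1.ne', one_smul]
  rw [add_smul, one_smul] at h2
  rw [smul_sub, sub_eq_sub_iff_add_eq_add, ← h2]
  abel

/-- Browder's theorem: as `r → 0`, the solutions of `z - T z = r • (u - z)` converge strongly to a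
fixed point of `T` satisfying the variational inequality of the projection of `u`. -/
theorem exists_tendsto_fixedPoint [CompleteSpace H] (hDcl : IsClosed D)
    (hT : ∀ x ∈ D, ∀ y ∈ D, ‖T x - T y‖ ≤ ‖x - y‖) (hF : ∃ p ∈ D, T p = p) {u : H}
    {r : ℕ → ℝ} (hr : ∀ k, 0 < r k) (hranti : StrictAnti r) (hr0 : Tendsto r atTop (𝓝 0))
    {z : ℕ → H} (hzD : ∀ k, z k ∈ D) (hz : ∀ k, z k - T (z k) = r k • (u - z k)) :
    ∃ q ∈ D, T q = q ∧ (∀ p ∈ D, T p = p → ⟪q - u, q - p⟫_ℝ ≤ 0) ∧ Tendsto z atTop (𝓝 q) := by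
  have hvar : ∀ p ∈ D, T p = p → ∀ k, ⟪z k - u, z k - p⟫_ℝ ≤ 0 := fun p hp hTp k => by
    have h := inner_sub_map_sub_nonneg hT (hzD k) hp
    rw [hTp, sub_self, sub_zero, hz, real_inner_smul_left, ← neg_sub (z k) u,
      inner_neg_left] at h
    nlinarith [hr k]
  obtain ⟨p, hp, hTp⟩ := hF
  have hbound : ∀ k, ‖z k - u‖ ≤ ‖p - u‖ := fun k => by
    have h := hvar p hp hTp k
    rw [show z k - p = (z k - u) - (p - u) by abel, inner_sub_right,
      real_inner_self_eq_norm_sq] at h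
    nlinarith [real_inner_le_norm (z k - u) (p - u), norm_nonneg (z k - u), norm_nonneg (p - u)]
  have hkey : ∀ j k, j < k → ‖z j - z k‖ ^ 2 ≤ ‖z k - u‖ ^ 2 - ‖z j - u‖ ^ 2 := fun j k hjk => by
    have h := inner_sub_map_sub_nonneg hT (hzD j) (hzD k)
    rw [hz, hz] at h
    have h1 : ‖z j - z k‖ ^ 2 = ‖z j - u‖ ^ 2 - 2 * ⟪z j - u, z k - u⟫_ℝ + ‖z k - u‖ ^ 2 := by
      rw [← norm_sub_sq_real]
      congr 2
      abel
    have h2 : ⟪r j • (u - z j) - r k • (u - z k), z j - z k⟫_ℝ =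
        -(r j * ‖z j - u‖ ^ 2 - (r j + r k) * ⟪z j - u, z k - u⟫_ℝ + r k * ‖z k - u‖ ^ 2) := by
      rw [show z j - z k = (z j - u) - (z k - u) by abel, ← neg_sub (z j) u, ← neg_sub (z k) u]
      generalize z j - u = v, z k - u = w
      simp only [inner_sub_left, inner_sub_right, inner_neg_left, real_inner_smul_left,
        smul_neg, real_inner_self_eq_norm_sq, real_inner_comm v w]
      ring
    rw [h2] at h
    have hlt := hranti hjk
    have h3 : (r j + r k) * ‖z j - z k‖ ^ 2 ≤
        (r j - r k) * (‖z k - u‖ ^ 2 - ‖z j - u‖ ^ 2) := by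
      rw [h1]
      linarith
    have h4 : 0 ≤ ‖z k - u‖ ^ 2 - ‖z j - u‖ ^ 2 := by
      by_contra! hneg
      nlinarith [hr j, hr k, mul_nonneg (add_pos (hr j) (hr k)).le (sq_nonneg ‖z j - z k‖)]
    nlinarith [hr j, hr k]
  have hmono : Monotone fun k => ‖z k - u‖ ^ 2 := fun j k hjk => by
    rcases hjk.eq_or_lt with rfl | hlt
    · exact le_rfl
    · nlinarith [hkey j k hlt, sq_nonneg ‖z j - z k‖]
  have hbdd : BddAbove (Set.range fun k => ‖z k - u‖ ^ 2) := by
    refine ⟨‖p - u‖ ^ 2, ?_⟩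
    rintro _ ⟨k, rfl⟩
    exact pow_le_pow_left₀ (norm_nonneg _) (hbound k) 2
  have hlim := tendsto_atTop_ciSup hmono hbdd
  set L := ⨆ k, ‖z k - u‖ ^ 2
  have hcauchy : CauchySeq z := by
    refine cauchySeq_of_le_tendsto_0' (fun k => √(L - ‖z k - u‖ ^ 2)) (fun j k hjk => ?_) ?_
    · rw [dist_eq_norm]
      refine Real.le_sqrt_of_sq_le ?_
      rcases hjk.eq_or_lt with rfl | hlt
      · simpa using le_ciSup hbdd j
      · linarith [hkey j k hlt, le_ciSup hbdd k]
    · simpa using (hlim.const_sub L).sqrt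
  obtain ⟨q, hq⟩ := cauchySeq_tendsto_of_complete hcauchy
  have hqD : q ∈ D := hDcl.mem_of_tendsto hq (.of_forall hzD)
  refine ⟨q, hqD, ?_, fun p hp hTp => ?_, hq⟩
  · have hTz : Tendsto (fun k => T (z k)) atTop (𝓝 q) := by
      have h := hq.sub (hr0.smul (hq.const_sub u))
      rw [zero_smul, sub_zero] at h
      exact h.congr fun k => by rw [← hz, sub_sub_cancel]
    have hTz' : Tendsto (fun k => T (z k)) atTop (𝓝 (T q)) := by
      rw [tendsto_iff_norm_sub_tendsto_zero] at hq ⊢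
      exact squeeze_zero (fun _ => norm_nonneg _) (fun k => hT _ (hzD k) _ hqD) hq
    exact tendsto_nhds_unique hTz' hTz
  · exact le_of_tendsto' ((hq.sub_const u).inner (hq.sub_const p)) (hvar p hp hTp)

/-- Along a bounded approximate fixed point sequence `x`, the upper limit of `⟪u - q, x n - q⟫` is
nonpositive, where `q` is the limit of solutions of `z - T z = r • (u - z)`. -/
theorem eventually_inner_sub_le (hT : ∀ x ∈ D, ∀ y ∈ D, ‖T x - T y‖ ≤ ‖x - y‖) {u q : H}
    {r : ℕ → ℝ} (hr : ∀ k, 0 < r k) {z : ℕ → H} (hzD : ∀ k, z k ∈ D)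
    (hz : ∀ k, z k - T (z k) = r k • (u - z k)) (hzq : Tendsto z atTop (𝓝 q))
    {x : ℕ → H} (hxD : ∀ n, x n ∈ D) {M : ℝ} (hM : ∀ n, ‖x n‖ ≤ M)
    (hTx : Tendsto (fun n => ‖T (x n) - x n‖) atTop (𝓝 0)) {ε : ℝ} (hε : 0 < ε) :
    ∀ᶠ n in atTop, ⟪u - q, x n - q⟫_ℝ ≤ ε := by
  have hdiff : ∀ k n, ⟪u - q, x n - q⟫_ℝ ≤
      ⟪u - z k, x n - z k⟫_ℝ + (‖z k - q‖ * (M + ‖q‖) + ‖u - z k‖ * ‖z k - q‖) := fun k n => by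
    have h : ⟪u - q, x n - q⟫_ℝ = ⟪u - z k, x n - z k⟫_ℝ +
        (⟪z k - q, x n - q⟫_ℝ + ⟪u - z k, z k - q⟫_ℝ) := by
      rw [← sub_add_sub_cancel u (z k) q, inner_add_left, ← sub_add_sub_cancel (x n) (z k) q,
        inner_add_right]
      ring
    rw [h]
    have h1 := real_inner_le_norm (u - z k) (z k - q)
    have h2 := real_inner_le_norm (z k - q) (x n - q)
    have h3 : ‖x n - q‖ ≤ M + ‖q‖ := (norm_sub_le _ _).trans (by linarith [hM n])
    linarith [mul_le_mul_of_nonneg_left h3 (norm_nonneg (z k - q))]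
  have hnorm : Tendsto (fun k => ‖z k - q‖) atTop (𝓝 0) :=
    tendsto_iff_norm_sub_tendsto_zero.1 hzq
  have hsmall : Tendsto (fun k => ‖z k - q‖ * (M + ‖q‖) + ‖u - z k‖ * ‖z k - q‖) atTop (𝓝 0) := by
    simpa using (hnorm.mul_const (M + ‖q‖)).add ((hzq.const_sub u).norm.mul hnorm)
  obtain ⟨k, hk⟩ := (hsmall.eventually_lt_const (half_pos hε)).exists
  have hmono : ∀ n, r k * ⟪u - z k, x n - z k⟫_ℝ ≤ ‖T (x n) - x n‖ * (M + ‖z k‖) := fun n => by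
    have h := inner_sub_map_sub_nonneg hT (hxD n) (hzD k)
    rw [hz, inner_sub_left, real_inner_smul_left] at h
    have h1 := real_inner_le_norm (x n - T (x n)) (x n - z k)
    have h2 : ‖x n - z k‖ ≤ M + ‖z k‖ := (norm_sub_le _ _).trans (by linarith [hM n])
    rw [norm_sub_rev (x n) (T (x n))] at h1
    linarith [mul_le_mul_of_nonneg_left h2 (norm_nonneg (T (x n) - x n))]
  have hlim : Tendsto (fun n => ‖T (x n) - x n‖ * (M + ‖z k‖)) atTop (𝓝 0) := by
    simpa using hTx.mul_const (M + ‖z k‖)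
  filter_upwards [hlim.eventually_lt_const (mul_pos (hr k) (half_pos hε))] with n hn
  have h := lt_of_mul_lt_mul_left ((hmono n).trans_lt hn) (hr k).le
  linarith [hdiff k n]

end Nonexpansive

/-- Theorem 3.2 of the paper (modified Ishikawa process with errors),
in the Hilbert-space setting. -/
theorem ishikawa_with_errors_converges
    {H : Type*} [NormedAddCommGroup H] [InnerProductSpace ℝ H] [CompleteSpace H]
    (D : Set H) (hDne : D.Nonempty) (hDcl : IsClosed D) (hDcv : Convex ℝ D)
    (T : H → H) (hTmaps : Set.MapsTo T D D)
    (hTne : ∀ x ∈ D, ∀ y ∈ D, ‖T x - T y‖ ≤ ‖x - y‖)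
    (hFne : ∃ p ∈ D, T p = p)
    (u : H) (hu : u ∈ D)
    (un vn : ℕ → H) (hun : ∀ n, un n ∈ D) (hvn : ∀ n, vn n ∈ D)
    (hunbdd : Bornology.IsBounded (Set.range un))
    (hvnbdd : Bornology.IsBounded (Set.range vn))
    (α γ β δ : ℕ → ℝ)
    (hαpos : ∀ n, 0 ≤ α n) (hγpos : ∀ n, 0 ≤ γ n)
    (hβpos : ∀ n, 0 ≤ β n) (hδpos : ∀ n, 0 ≤ δ n)
    (hαγ : ∀ n, α n + γ n ≤ 1)
    (hβδ : ∀ n, 0 < β n + δ n ∧ β n + δ n ≤ 1)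
    (hα0 : Tendsto α atTop (𝓝 0))
    (hαdiv : ¬ Summable α)
    (hγsum : Summable γ) (hδsum : Summable δ)
    (hratio : Tendsto (fun n => γ n / (α n + γ n)) atTop (𝓝 0))
    (x y : ℕ → H) (hx0 : x 0 ∈ D)
    (hxrec : ∀ n, x (n + 1) = α n • u + (1 - α n - γ n) • T (y n) + γ n • un n)
    (hyrec : ∀ n, y n = β n • x n + (1 - β n - δ n) • T (x n) + δ n • vn n)
    (hxbdd : Bornology.IsBounded (Set.range x))
    (hTx : Tendsto (fun n => ‖T (x n) - x n‖) atTop (𝓝 0)) :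
    ∃ q ∈ D, T q = q ∧ (∀ p ∈ D, T p = p → ⟪q - u, q - p⟫_ℝ ≤ 0) ∧
      Tendsto x atTop (𝓝 q) := by
  obtain ⟨r, hranti, hr, hr0⟩ := exists_seq_strictAnti_tendsto (0 : ℝ)
  choose z hzD hz using fun k => exists_sub_map_eq_smul hDcl hDcv hTmaps hTne hu (hr k)
  obtain ⟨q, hqD, hTq, hqvar, hzq⟩ :=
    exists_tendsto_fixedPoint hDcl hTne hFne hr hranti hr0 hzD hz
  refine ⟨q, hqD, hTq, hqvar, ?_⟩
  have hcoef : ∀ n, 0 ≤ 1 - β n - δ n := fun n => by linarith [(hβδ n).2]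
  have hcoef' : ∀ n, 0 ≤ 1 - α n - γ n := fun n => by linarith [hαγ n]
  have hyD_of : ∀ n, x n ∈ D → y n ∈ D := fun n hn => by
    rw [hyrec]
    exact hDcv.add_smul_three_mem hn (hTmaps hn) (hvn n) (hβpos n) (hcoef n) (hδpos n) (by ring)
  have hxD : ∀ n, x n ∈ D := fun n => by
    induction n with
    | zero => exact hx0
    | succ n ih =>
      rw [hxrec]
      exact hDcv.add_smul_three_mem hu (hTmaps (hyD_of n ih)) (hun n) (hαpos n) (hcoef' n)
        (hγpos n) (by ring)
  have hyD : ∀ n, y n ∈ D := fun n => hyD_of n (hxD n)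
  obtain ⟨M, hM⟩ := hxbdd.exists_norm_le
  obtain ⟨A, hA⟩ := hunbdd.exists_norm_le
  obtain ⟨B, hB⟩ := hvnbdd.exists_norm_le
  replace hM : ∀ n, ‖x n‖ ≤ M := fun n => hM _ ⟨n, rfl⟩
  have hA' : ∀ n, ‖un n - q‖ ^ 2 ≤ (A + ‖q‖) ^ 2 := fun n =>
    pow_le_pow_left₀ (norm_nonneg _) ((norm_sub_le _ _).trans (by linarith [hA _ ⟨n, rfl⟩])) 2
  have hB' : ∀ n, ‖vn n - q‖ ^ 2 ≤ (B + ‖q‖) ^ 2 := fun n =>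
    pow_le_pow_left₀ (norm_nonneg _) ((norm_sub_le _ _).trans (by linarith [hB _ ⟨n, rfl⟩])) 2
  have hTsq : ∀ w ∈ D, ‖T w - q‖ ^ 2 ≤ ‖w - q‖ ^ 2 := fun w hw => by
    have h := hTne w hw q hqD
    rw [hTq] at h
    exact pow_le_pow_left₀ (norm_nonneg _) h 2
  have hy : ∀ n, ‖y n - q‖ ^ 2 ≤ ‖x n - q‖ ^ 2 + δ n * (B + ‖q‖) ^ 2 := fun n => by
    have h : y n - q = β n • (x n - q) + (1 - β n - δ n) • (T (x n) - q) + δ n • (vn n - q) := by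
      rw [hyrec]
      module
    rw [h]
    refine (norm_add_smul_three_sq_le _ _ _ (hβpos n) (hcoef n) (hδpos n) (by ring)).trans ?_
    nlinarith [mul_le_mul_of_nonneg_left (hTsq _ (hxD n)) (hcoef n),
      mul_le_mul_of_nonneg_left (hB' n) (hδpos n), mul_nonneg (hδpos n) (sq_nonneg ‖x n - q‖)]
  have hstep : ∀ n, ‖x (n + 1) - q‖ ^ 2 ≤ (1 - α n) * ‖x n - q‖ ^ 2 +
      α n * (2 * ⟪u - q, x (n + 1) - q⟫_ℝ) +
      (δ n * (B + ‖q‖) ^ 2 + γ n * (A + ‖q‖) ^ 2) := fun n => by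
    set w := α n • (0 : H) + (1 - α n - γ n) • (T (y n) - q) + γ n • (un n - q) with hw
    have h : w = (x (n + 1) - q) - α n • (u - q) := by
      rw [hw, hxrec]
      module
    have h1 : ‖x (n + 1) - q‖ ^ 2 ≤ ‖w‖ ^ 2 + α n * (2 * ⟪u - q, x (n + 1) - q⟫_ℝ) := by
      rw [h, norm_sub_sq_real (x (n + 1) - q), real_inner_smul_right, real_inner_comm]
      nlinarith [sq_nonneg ‖α n • (u - q)‖]
    have h2 : ‖w‖ ^ 2 ≤ (1 - α n) * ‖x n - q‖ ^ 2 +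
        (δ n * (B + ‖q‖) ^ 2 + γ n * (A + ‖q‖) ^ 2) := by
      refine (norm_add_smul_three_sq_le _ _ _ (hαpos n) (hcoef' n) (hγpos n) (by ring)).trans ?_
      rw [norm_zero]
      nlinarith [mul_le_mul_of_nonneg_left ((hTsq _ (hyD n)).trans (hy n)) (hcoef' n),
        mul_le_mul_of_nonneg_left (hA' n) (hγpos n), mul_nonneg (hγpos n) (sq_nonneg ‖x n - q‖),
        mul_nonneg (add_nonneg (hαpos n) (hγpos n))
          (mul_nonneg (hδpos n) (sq_nonneg (B + ‖q‖)))]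
    linarith
  have hsq : Tendsto (fun n => ‖x n - q‖ ^ 2) atTop (𝓝 0) := by
    refine tendsto_zero_of_le_one_sub_mul_add_mul_add (fun n => sq_nonneg _) hαpos
      (fun n => by linarith [hαγ n, hγpos n]) hαdiv
      (fun n => add_nonneg (mul_nonneg (hδpos n) (sq_nonneg _))
        (mul_nonneg (hγpos n) (sq_nonneg _)))
      ((hδsum.mul_right _).add (hγsum.mul_right _)) (fun ε hε => ?_) hstep
    filter_upwards [(tendsto_add_atTop_nat 1).eventually
      (eventually_inner_sub_le hTne hr hzD hz hzq hxD hM hTx (half_pos hε))] with n hn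
    linarith
  rw [tendsto_iff_norm_sub_tendsto_zero]
  simpa using hsq.sqrt
end

section
/- Let {a_n}, {b_n}, {c_n} be nonnegative real sequences and {t_n} ⊂ [0,1] such that a_{n+1} ≤ (1 − t_n) a_n + b_n + c_n for all n ≥ 0, ∑_{n=0}^∞ t_n = ∞, b_n = o(t_n), and ∑_{n=0}^∞ c_n < ∞. Then lim_{n→∞} a_n = 0. -/
open Filter Topology

/-- Iterating `a (n + 1) ≤ (1 - t n) * a n + ε * t n + c n`, the excess of `a` over `ε` is bounded by
an exponentially damped initial value plus the accumulated errors. -/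
theorem le_exp_neg_sum_mul_add_sum {a c t : ℕ → ℝ} {ε : ℝ} (ha : 0 ≤ a 0) (hε : 0 ≤ ε)
    (hc : ∀ n, 0 ≤ c n) (ht : ∀ n, t n ∈ Set.Icc (0 : ℝ) 1)
    (hrec : ∀ n, a (n + 1) ≤ (1 - t n) * a n + ε * t n + c n) (n : ℕ) :
    a n ≤ ε + Real.exp (-∑ i ∈ Finset.range n, t i) * a 0 + ∑ i ∈ Finset.range n, c i := by
  induction n with
  | zero => simpa using hε
  | succ n ih =>
    rw [Finset.sum_range_succ, Finset.sum_range_succ, neg_add, Real.exp_add]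
    set P := Real.exp (-∑ i ∈ Finset.range n, t i) * a 0 with hP
    have hP0 : 0 ≤ P := by positivity
    have hS : 0 ≤ ∑ i ∈ Finset.range n, c i := Finset.sum_nonneg fun i _ ↦ hc i
    have hstep := mul_le_mul_of_nonneg_left ih (sub_nonneg.2 (ht n).2)
    have hexp := mul_le_mul_of_nonneg_right (Real.one_sub_le_exp_neg (t n)) hP0
    have htS := mul_nonneg (ht n).1 hS
    have hcomm : Real.exp (-∑ i ∈ Finset.range n, t i) * Real.exp (-t n) * a 0
        = Real.exp (-t n) * P := by rw [hP]; ring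
    rw [hcomm]
    linarith [hrec n]

/-- Lemma 1.3 of the paper (Liu's numerical recursion lemma). -/
theorem liu_recursion_lemma
    (a b c t : ℕ → ℝ)
    (ha : ∀ n, 0 ≤ a n) (hb : ∀ n, 0 ≤ b n) (hc : ∀ n, 0 ≤ c n)
    (ht : ∀ n, t n ∈ Set.Icc (0 : ℝ) 1)
    (hrec : ∀ n, a (n + 1) ≤ (1 - t n) * a n + b n + c n)
    (htdiv : ¬ Summable t)
    (hbo : ∀ ε > (0 : ℝ), ∃ N, ∀ n ≥ N, b n ≤ ε * t n)
    (hcsum : Summable c) :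
    Tendsto a atTop (𝓝 0) := by
  rw [Metric.tendsto_atTop']
  intro δ hδ
  have hε : 0 < δ / 3 := by positivity
  obtain ⟨M, hM⟩ := hbo (δ / 3) hε
  obtain ⟨N, hcN, hMN⟩ :=
    (((tendsto_sum_nat_add c).eventually_lt_const hε).and (eventually_ge_atTop M)).exists
  have htN : ¬ Summable fun n ↦ t (n + N) := by rwa [summable_nat_add_iff]
  have hlim : Tendsto (fun n ↦ Real.exp (-∑ i ∈ Finset.range n, t (i + N)) * a N) atTop (𝓝 0) := by
    have htop := (not_summable_iff_tendsto_nat_atTop_of_nonneg fun n ↦ (ht (n + N)).1).1 htN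
    simpa using (Real.tendsto_exp_neg_atTop_nhds_zero.comp htop).mul_const (a N)
  obtain ⟨K, hK⟩ := eventually_atTop.1 (hlim.eventually_lt_const hε)
  refine ⟨K + N, fun n hn ↦ ?_⟩
  obtain ⟨k, rfl⟩ : ∃ k, n = k + N := ⟨n - N, by omega⟩
  have hbound := le_exp_neg_sum_mul_add_sum (a := fun n ↦ a (n + N)) (c := fun n ↦ c (n + N))
    (t := fun n ↦ t (n + N)) (ha _) hε.le (fun _ ↦ hc _) (fun _ ↦ ht _)
    (fun n ↦ by
      have h := hrec (n + N)
      rw [add_right_comm] at h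
      linarith [hM (n + N) (by omega)]) k
  have hsum := ((summable_nat_add_iff N).2 hcsum).sum_le_tsum (Finset.range k) fun i _ ↦ hc (i + N)
  have hKk := hK k (by omega)
  simp only [zero_add] at hbound
  rw [Real.dist_eq, sub_zero, abs_of_nonneg (ha _)]
  linarith
end

section
/- Let E be a real Banach space, D a nonempty closed convex subset of E, T : D → D a nonexpansive mapping, f : D → D an α-contraction with α ∈ (0,1), g : D → D any mapping, and t ∈ (0,1). Suppose z ∈ D satisfies z = t g(z) + (1 − t) T z and z' ∈ D satisfies z' = t f(z') + (1 − t) T z'. Then (1 − α)‖z − z'‖ ≤ ‖g(z) − f(z)‖. -/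
open Filter Topology

/-- The key comparison estimate from the proof of Lemma 2.1 of the paper. -/
theorem path_comparison_estimate
    {E : Type*} [NormedAddCommGroup E] [NormedSpace ℝ E]
    (D : Set E) (hDne : D.Nonempty) (hDcl : IsClosed D) (hDcv : Convex ℝ D)
    (T : E → E) (hTmaps : Set.MapsTo T D D)
    (hTne : ∀ x ∈ D, ∀ y ∈ D, ‖T x - T y‖ ≤ ‖x - y‖)
    (f : E → E) (hfmaps : Set.MapsTo f D D)
    (a : ℝ) (ha : a ∈ Set.Ioo (0 : ℝ) 1)
    (hf : ∀ x ∈ D, ∀ y ∈ D, ‖f x - f y‖ ≤ a * ‖x - y‖)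
    (g : E → E) (hgmaps : Set.MapsTo g D D)
    (t : ℝ) (ht : t ∈ Set.Ioo (0 : ℝ) 1)
    (z : E) (hzD : z ∈ D) (hz : z = t • g z + (1 - t) • T z)
    (z' : E) (hz'D : z' ∈ D) (hz' : z' = t • f z' + (1 - t) • T z') :
    (1 - a) * ‖z - z'‖ ≤ ‖g z - f z‖ := by
  have hfz := hf z hzD z' hz'D
  have hT := hTne z hzD z' hz'D
  obtain ⟨ht0, ht1⟩ := ht
  have hsub : z - z' = t • (g z - f z) + t • (f z - f z') + (1 - t) • (T z - T z') := by
    calc z - z' = (t • g z + (1 - t) • T z) - (t • f z' + (1 - t) • T z') := by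
          rw [← hz, ← hz']
      _ = _ := by module
  have hnorm : ‖z - z'‖ ≤ t * ‖g z - f z‖ + t * ‖f z - f z'‖ + (1 - t) * ‖T z - T z'‖ := by
    calc ‖z - z'‖ = ‖t • (g z - f z) + t • (f z - f z') + (1 - t) • (T z - T z')‖ :=
          congrArg norm hsub
      _ ≤ ‖t • (g z - f z)‖ + ‖t • (f z - f z')‖ + ‖(1 - t) • (T z - T z')‖ := norm_add₃_le
      _ = _ := by
          rw [norm_smul_of_nonneg ht0.le, norm_smul_of_nonneg ht0.le,
            norm_smul_of_nonneg (sub_nonneg.2 ht1.le)]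
  have hf' := mul_le_mul_of_nonneg_left hfz ht0.le
  have hT' := mul_le_mul_of_nonneg_left hT (sub_nonneg.2 ht1.le)
  refine le_of_mul_le_mul_left ?_ ht0
  linarith
end
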